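/- The map χ_U : Conf_U(A) → Emb_U(A), sending a configuration ⟨x_a⟩ to the family of maps u ↦ x_a + (d·u)/(d + 2‖u‖) where d = min_{a'≠a''} ‖x_{a'} − x_{a''}‖, lands in embeddings: each component is a topological embedding of U into U, and the components have pairwise disjoint images. -/

import Mathlib

/-- The map `χ_U : Conf_U(A) → Emb_U(A)`, sending a configuration `⟨x_a⟩` to
the family of maps `u ↦ x_a + (d·u)/(d + 2‖u‖)` where
`d = min_{a' ≠ a''} ‖x_{a'} − x_{a''}‖`, lands in embeddings: each component is a
topological embedding of `U` into `U`, and the components have pairwise disjoint images. -/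
theorem stmt_10 (U : Type) [NormedAddCommGroup U] [InnerProductSpace ℝ U]
    [FiniteDimensional ℝ U] (hU : 1 ≤ Module.finrank ℝ U)
    (A : Type) [Fintype A] (hA : 2 ≤ Fintype.card A)
    (x : A → U) (hx : Function.Injective x) :
    let d : ℝ := sInf { r : ℝ | ∃ a a' : A, a ≠ a' ∧ r = ‖x a - x a'‖ }
    (∀ a : A, Topology.IsEmbedding fun u : U => x a + (d / (d + 2 * ‖u‖)) • u) ∧
    Pairwise fun a a' : A =>
      Disjoint (Set.range fun u : U => x a + (d / (d + 2 * ‖u‖)) • u)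
        (Set.range fun u : U => x a' + (d / (d + 2 * ‖u‖)) • u) := by
  intro d
  have hfin : Set.Finite { r : ℝ | ∃ a a' : A, a ≠ a' ∧ r = ‖x a - x a'‖ } := by
    refine (Set.finite_range (fun p : A × A => ‖x p.1 - x p.2‖)).subset ?_
    rintro r ⟨a, b, -, rfl⟩
    exact ⟨(a, b), rfl⟩
  have hne : Set.Nonempty { r : ℝ | ∃ a a' : A, a ≠ a' ∧ r = ‖x a - x a'‖ } := by
    obtain ⟨a, b, hab⟩ := Fintype.exists_pair_of_one_lt_card (α := A) (by omega)
    exact ⟨_, a, b, hab, rfl⟩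
  have hle : ∀ a b : A, a ≠ b → d ≤ ‖x a - x b‖ := fun a b hab =>
    csInf_le hfin.bddBelow ⟨a, b, hab, rfl⟩
  have hd : 0 < d := by
    obtain ⟨a, b, hab, h⟩ := hne.csInf_mem hfin
    have h' : d = ‖x a - x b‖ := h
    rw [h', norm_pos_iff, sub_ne_zero]
    exact fun h => hab (hx h)
  clear_value d
  have hpos : ∀ u : U, 0 < d + 2 * ‖u‖ := fun u => by positivity
  have hnorm : ∀ u : U, ‖(d / (d + 2 * ‖u‖)) • u‖ = d * ‖u‖ / (d + 2 * ‖u‖) := by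
    intro u
    rw [norm_smul, Real.norm_of_nonneg (div_pos hd (hpos u)).le]
    ring
  have hlt : ∀ u : U, ‖(d / (d + 2 * ‖u‖)) • u‖ < d / 2 := by
    intro u
    rw [hnorm, div_lt_div_iff₀ (hpos u) two_pos]
    nlinarith [mul_pos hd hd]
  constructor
  · intro a
    let f : U → {y : U // ‖y - x a‖ < d / 2} := fun u =>
      ⟨x a + (d / (d + 2 * ‖u‖)) • u, by rw [add_sub_cancel_left]; exact hlt u⟩
    let g : {y : U // ‖y - x a‖ < d / 2} → U := fun y =>
      (d / (d - 2 * ‖y.1 - x a‖)) • (y.1 - x a)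
    have hf : Continuous f := by
      refine Continuous.subtype_mk ?_ _
      refine continuous_const.add (Continuous.smul ?_ continuous_id)
      exact continuous_const.div (by fun_prop) (fun u => (hpos u).ne')
    have hg : Continuous g := by
      refine Continuous.smul ?_ (by fun_prop)
      refine continuous_const.div (by fun_prop) (fun y => ?_)
      have := y.2
      linarith
    have hgf : Function.LeftInverse g f := by
      intro u
      have hp := hpos u
      change (d / (d - 2 * ‖x a + (d / (d + 2 * ‖u‖)) • u - x a‖)) •
        (x a + (d / (d + 2 * ‖u‖)) • u - x a) = u
      rw [add_sub_cancel_left, hnorm, smul_smul]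
      have h1 : d - 2 * (d * ‖u‖ / (d + 2 * ‖u‖)) = d * d / (d + 2 * ‖u‖) := by
        field_simp
        ring
      rw [h1]
      have h2 : d / (d * d / (d + 2 * ‖u‖)) * (d / (d + 2 * ‖u‖)) = 1 := by
        field_simp
      rw [h2, one_smul]
    exact Topology.IsEmbedding.subtypeVal.comp (hgf.isEmbedding hg hf)
  · intro a b hab
    rw [Set.disjoint_left]
    rintro y ⟨u, rfl⟩ ⟨v, hv⟩
    have h := hle a b hab
    have h2 : x a - x b = (d / (d + 2 * ‖v‖)) • v - (d / (d + 2 * ‖u‖)) • u := by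
      rw [sub_eq_sub_iff_add_eq_add, add_comm _ (x b)]
      exact hv.symm
    rw [h2] at h
    have := norm_sub_le ((d / (d + 2 * ‖v‖)) • v) ((d / (d + 2 * ‖u‖)) • u)
    linarith [hlt u, hlt v]
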